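/- Let N ≥ 2 and let m₀, …, m_{N−1} ∈ L^∞(𝕋) be such that for almost every z ∈ 𝕋 the matrix (m_i(w_j(z)))_{i,j}, where w₀(z), …, w_{N−1}(z) are the N distinct N-th roots of z, is unitary. Define S_i f(z) = √N m_i(z) f(z^N) on L²(𝕋). Then the S_i satisfy the Cuntz relations: S_i* S_j = δ_{ij} I and Σ_{i=0}^{N−1} S_i S_i* = I. -/

import Mathlib

open MeasureTheory Complex
open scoped ComplexConjugate ENNReal

noncomputable instance : MeasurableSpace Circle := borel Circle
instance : BorelSpace Circle := ⟨rfl⟩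

/-- Normalized Haar measure on the circle `𝕋` (Haar measure on a compact group is normalized). -/
noncomputable def μC : Measure Circle := Measure.haar

/-- A fixed measurable branch of the `N`-th root on the circle. -/
noncomputable def nthRoot (N : ℕ) (z : Circle) : Circle := Circle.exp ((z : ℂ).arg / N)

/-- The `N`-th roots of `z` : `σ_k(z) = e^{2πik/N} z^{1/N}`, `k = 0, …, N-1`. -/
noncomputable def circRoots (N : ℕ) (z : Circle) (k : Fin N) : Circle :=
  Circle.exp (2 * Real.pi * (k : ℝ) / N) * nthRoot N z

/-- `rootSum N F z = Σ_{w : w^N = z} F w`, the sum over the `N`-th roots of `z`. -/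
noncomputable def rootSum (N : ℕ) (F : Circle → ℂ) (z : Circle) : ℂ :=
  ∑ k : Fin N, F (circRoots N z k)

theorem coe_circRoots (N : ℕ) (z : Circle) (k : Fin N) :
    (circRoots N z k : ℂ) = Complex.exp (2 * Real.pi * I / N) ^ (k : ℕ) * nthRoot N z := by
  rw [circRoots, Circle.coe_mul, Circle.coe_exp, ← Complex.exp_nat_mul]
  push_cast
  congr 2
  ring

theorem nthRoot_pow {N : ℕ} (hN : N ≠ 0) (z : Circle) : nthRoot N z ^ N = z := by
  have hN' : (N : ℝ) ≠ 0 := Nat.cast_ne_zero.mpr hN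
  rw [nthRoot, ← Circle.exp_natCast_mul, mul_div_cancel₀ _ hN', Circle.exp_arg]

theorem circRoots_pow {N : ℕ} (hN : N ≠ 0) (z : Circle) (k : Fin N) :
    circRoots N z k ^ N = z := by
  apply Circle.ext
  rw [Circle.coe_pow, coe_circRoots, mul_pow, pow_right_comm,
    (Complex.isPrimitiveRoot_exp N hN).pow_eq_one, one_pow, one_mul, ← Circle.coe_pow,
    nthRoot_pow hN]

theorem circRoots_injective {N : ℕ} (hN : N ≠ 0) (z : Circle) :
    Function.Injective (circRoots N z) := by
  intro k l h
  have h' := congrArg (fun w : Circle => (w : ℂ)) h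
  simp only [coe_circRoots] at h'
  exact Fin.ext ((Complex.isPrimitiveRoot_exp N hN).pow_inj k.2 l.2
    (mul_right_cancel₀ (Circle.coe_ne_zero _) h'))

theorem exists_circRoots_eq {N : ℕ} (hN : N ≠ 0) {w z : Circle} (h : w ^ N = z) :
    ∃ k, circRoots N z k = w := by
  have : NeZero N := ⟨hN⟩
  have h1 : ((w / nthRoot N z : Circle) : ℂ) ^ N = 1 := by
    rw [← Circle.coe_pow, div_pow, nthRoot_pow hN, h, div_self', Circle.coe_one]
  obtain ⟨i, hi, hi'⟩ := (Complex.isPrimitiveRoot_exp N hN).eq_pow_of_pow_eq_one h1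
  refine ⟨⟨i, hi⟩, Circle.ext ?_⟩
  rw [coe_circRoots]
  simp only [hi']
  rw [← Circle.coe_mul, div_mul_cancel]

theorem bijOn_circRoots {N : ℕ} (hN : N ≠ 0) (z : Circle) :
    Set.BijOn (circRoots N z) Set.univ {w | w ^ N = z} :=
  ⟨fun k _ => circRoots_pow hN z k, (circRoots_injective hN z).injOn,
    fun _ hw => by simpa using exists_circRoots_eq hN hw⟩

/-- Multiplication by `u` carries the `N`-th roots of `z` onto those of `u ^ N * z`. -/
theorem sum_mul_circRoots {M : Type*} [AddCommMonoid M] {N : ℕ} (hN : N ≠ 0) (F : Circle → M)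
    (u z : Circle) :
    ∑ k, F (u * circRoots N z k) = ∑ k, F (circRoots N (u ^ N * z) k) := by
  have hu : Set.BijOn (fun k => u * circRoots N z k) Set.univ {w | w ^ N = u ^ N * z} := by
    refine ⟨fun k _ => ?_, fun k _ l _ h => circRoots_injective hN z (mul_left_cancel h), ?_⟩
    · simp [mul_pow, circRoots_pow hN]
    · intro w hw
      obtain ⟨k, hk⟩ := exists_circRoots_eq hN (w := u⁻¹ * w) (z := z) (by
        rw [mul_pow, show w ^ N = u ^ N * z from hw, inv_pow, inv_mul_cancel_left])
      exact ⟨k, Set.mem_univ _, by simp [hk]⟩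
  have h1 := finsum_mem_eq_of_bijOn (f := fun k => F (u * circRoots N z k)) (g := F) _ hu
    fun _ _ => rfl
  have h2 := finsum_mem_eq_of_bijOn (f := fun k => F (circRoots N (u ^ N * z) k)) (g := F) _
    (bijOn_circRoots hN (u ^ N * z)) fun _ _ => rfl
  rw [← finsum_eq_sum_of_fintype, ← finsum_eq_sum_of_fintype, ← finsum_mem_univ, h1,
    ← h2, finsum_mem_univ]

theorem measurable_circRoots (N : ℕ) (k : Fin N) : Measurable fun z => circRoots N z k := by
  unfold circRoots nthRoot
  refine (continuous_const_mul _).measurable.comp (Circle.exp.continuous.measurable.comp ?_)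
  have hc : Measurable fun z : Circle => (z : ℂ) :=
    Continuous.measurable (α := Circle) continuous_subtype_val
  exact (Complex.measurable_arg.comp hc).div_const (N : ℝ)

instance : μC.IsHaarMeasure := by unfold μC; infer_instance

/-- The pull-back of `μC` along the `N`-th power map is `N` times `μC`. -/
theorem sum_map_circRoots {N : ℕ} (hN : N ≠ 0) :
    ∑ k : Fin N, μC.map (fun z => circRoots N z k) = (N : ℝ≥0∞) • μC := by
  set ν := ∑ k : Fin N, μC.map (fun z => circRoots N z k) with hν
  have hint : ∀ A, MeasurableSet A →
      ν A = ∫⁻ z, ∑ k, A.indicator (1 : Circle → ℝ≥0∞) (circRoots N z k) ∂μC := by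
    intro A hA
    have hmeas : ∀ k : Fin N, Measurable fun z =>
        A.indicator (1 : Circle → ℝ≥0∞) (circRoots N z k) := fun k =>
      (measurable_one.indicator hA).comp (measurable_circRoots N k)
    rw [lintegral_finsetSum _ fun k _ => hmeas k, hν,
      Measure.finsetSum_apply]
    refine Finset.sum_congr rfl fun k _ => ?_
    rw [← lintegral_map (measurable_one.indicator hA) (measurable_circRoots N k),
      lintegral_indicator_one hA]
  have huniv : ν Set.univ = N * μC Set.univ := by
    rw [hint _ MeasurableSet.univ]
    simp
  have : IsFiniteMeasure ν := ⟨by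
    rw [huniv]; exact ENNReal.mul_lt_top (ENNReal.natCast_lt_top N) (measure_lt_top _ _)⟩
  have : ν.IsMulLeftInvariant := ⟨fun u => by
    ext A hA
    have hu : Measurable fun w : Circle => u * w := (continuous_const_mul u).measurable
    rw [Measure.map_apply hu hA, hint _ (hu hA), hint _ hA,
      ← lintegral_mul_left_eq_self (μ := μC)
        (fun z => ∑ k, A.indicator (1 : Circle → ℝ≥0∞) (circRoots N z k)) (u ^ N)]
    refine lintegral_congr fun z => ?_
    rw [← sum_mul_circRoots hN]
    rfl⟩
  have h := Measure.isMulInvariant_eq_smul_of_compactSpace ν μC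
  rw [h]
  have h' := huniv
  rw [h, Measure.smul_apply, ENNReal.smul_def, smul_eq_mul] at h'
  have hc := (ENNReal.mul_left_inj (Measure.measure_univ_ne_zero.mpr (NeZero.ne μC))
    (measure_ne_top μC _)).mp h'
  ext A
  rw [Measure.smul_apply, Measure.smul_apply, ENNReal.smul_def, hc]

theorem map_circRoots_le {N : ℕ} (hN : N ≠ 0) (k : Fin N) :
    μC.map (fun z => circRoots N z k) ≤ (N : ℝ≥0∞) • μC := by
  rw [← sum_map_circRoots hN]
  exact Finset.single_le_sum (f := fun k : Fin N => μC.map (fun z => circRoots N z k))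
    (fun _ _ => Measure.zero_le _) (Finset.mem_univ k)

theorem quasiMeasurePreserving_circRoots {N : ℕ} (hN : N ≠ 0) (k : Fin N) :
    Measure.QuasiMeasurePreserving (fun z => circRoots N z k) μC μC :=
  ⟨measurable_circRoots N k,
    (Measure.absolutelyContinuous_of_le (map_circRoots_le hN k)).trans
      Measure.smul_absolutelyContinuous⟩

theorem quasiMeasurePreserving_pow_circle {N : ℕ} (hN : N ≠ 0) :
    Measure.QuasiMeasurePreserving (fun z : Circle => z ^ N) μC μC := by
  have hp : Measurable fun z : Circle => z ^ N := (continuous_pow N).measurable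
  refine ⟨hp, fun A hA => ?_⟩
  obtain ⟨B, hAB, hB, hB0⟩ := exists_measurable_superset_of_null hA
  refine measure_mono_null hAB ?_
  rw [Measure.map_apply hp hB]
  have h : ((N : ℝ≥0∞) • μC) ((fun z : Circle => z ^ N) ⁻¹' B) = 0 := by
    rw [← sum_map_circRoots hN, Measure.finsetSum_apply]
    refine Finset.sum_eq_zero fun k _ => ?_
    rw [Measure.map_apply (measurable_circRoots N k) (hp hB), ← Set.preimage_comp]
    simpa [Function.comp_def, circRoots_pow hN] using hB0
  simpa [hN] using h

/-- Integration over the circle by averaging over `N`-th roots. -/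
theorem integral_rootSum {N : ℕ} (hN : N ≠ 0) {F : Circle → ℂ} (hF : Integrable F μC) :
    ∫ z, rootSum N F z ∂μC = N * ∫ z, F z ∂μC := by
  have hFk : ∀ k : Fin N, Integrable F (μC.map fun z => circRoots N z k) := fun k =>
    (hF.smul_measure (ENNReal.natCast_ne_top N)).mono_measure (map_circRoots_le hN k)
  have h : ∫ z, F z ∂((N : ℝ≥0∞) • μC) = N * ∫ z, F z ∂μC := by
    rw [integral_smul_measure]; simp
  rw [← h, ← sum_map_circRoots hN, integral_finsetSum_measure fun k _ => hFk k]
  have hint : ∀ k : Fin N, Integrable (fun z => F (circRoots N z k)) μC := fun k =>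
    (hFk k).comp_measurable (measurable_circRoots N k)
  unfold rootSum
  rw [integral_finsetSum _ fun k _ => hint k]
  refine Finset.sum_congr rfl fun k _ => ?_
  rw [integral_map (measurable_circRoots N k).aemeasurable (hFk k).aestronglyMeasurable]

theorem memLp_comp_circRoots {N : ℕ} (hN : N ≠ 0) (k : Fin N) {p : ℝ≥0∞} {g : Circle → ℂ}
    (hg : MemLp g p μC) : MemLp (fun z => g (circRoots N z k)) p μC :=
  ((hg.smul_measure (ENNReal.natCast_ne_top N)).mono_measure (map_circRoots_le hN k)).comp_of_map
    (measurable_circRoots N k).aemeasurable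

theorem memLp_rootSum_conj_mul {N : ℕ} (hN : N ≠ 0) {p : ℝ≥0∞} {φ g : Circle → ℂ} {C : ℝ}
    (hφ : Measurable φ) (hC : ∀ z, ‖φ z‖ ≤ C) (hg : MemLp g p μC) :
    MemLp (rootSum N fun w => conj (φ w) * g w) p μC := by
  unfold rootSum
  refine memLp_finsetSum _ fun k _ => ?_
  have hgk := memLp_comp_circRoots hN k hg
  have hφk : Measurable fun z => conj (φ (circRoots N z k)) :=
    Complex.continuous_conj.measurable.comp (hφ.comp (measurable_circRoots N k))
  refine hgk.of_le_mul (c := C) (hφk.aestronglyMeasurable.mul hgk.1) (ae_of_all _ fun z => ?_)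
  rw [norm_mul, RCLike.norm_conj]
  exact mul_le_mul_of_nonneg_right (hC _) (norm_nonneg _)

theorem sum_star_mul_of_mem_unitaryGroup {N : ℕ} {U : Matrix (Fin N) (Fin N) ℂ}
    (hU : U ∈ Matrix.unitaryGroup (Fin N) ℂ) (k l : Fin N) :
    ∑ i, conj (U i k) * U i l = if k = l then 1 else 0 := by
  have h := congrFun (congrFun (Matrix.mem_unitaryGroup_iff'.mp hU) k) l
  rwa [Matrix.mul_apply, Matrix.one_apply] at h

theorem sum_mul_star_of_mem_unitaryGroup {N : ℕ} {U : Matrix (Fin N) (Fin N) ℂ}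
    (hU : U ∈ Matrix.unitaryGroup (Fin N) ℂ) (i j : Fin N) :
    ∑ k, U j k * conj (U i k) = if i = j then 1 else 0 := by
  have h := congrFun (congrFun (Matrix.mem_unitaryGroup_iff.mp hU) j) i
  rw [Matrix.mul_apply, Matrix.one_apply] at h
  simp only [eq_comm (a := i)]
  exact h

/-- If the matrix of the `m_i` at the `N`-th roots of `z` is a.e. unitary, then the
operators `S_i f(z) = √N m_i(z) f(z^N)` satisfy the Cuntz relations
`S_i* S_j = δ_{ij} I` and `Σ_i S_i S_i* = I`. -/
theorem stmt2 (N : ℕ) (hN : 2 ≤ N) (m : Fin N → Circle → ℂ)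
    (hm_meas : ∀ i, Measurable (m i)) (hm_bdd : ∀ i, ∃ C, ∀ z, ‖m i z‖ ≤ C)
    (hunitary : ∀ᵐ z ∂μC,
      (Matrix.of fun i j : Fin N => m i (circRoots N z j)) ∈ Matrix.unitaryGroup (Fin N) ℂ)
    (S : Fin N → (Lp ℂ 2 μC →L[ℂ] Lp ℂ 2 μC))
    (hS : ∀ i (f : Lp ℂ 2 μC),
      (S i f : Circle → ℂ) =ᵐ[μC] fun z => (Real.sqrt N : ℂ) * m i z * f (z ^ N)) :
    (∀ i j, (ContinuousLinearMap.adjoint (S i)).comp (S j)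
        = if i = j then ContinuousLinearMap.id ℂ (Lp ℂ 2 μC) else 0) ∧
    ∑ i : Fin N, (S i).comp (ContinuousLinearMap.adjoint (S i))
        = ContinuousLinearMap.id ℂ (Lp ℂ 2 μC) := by
  have hN0 : N ≠ 0 := by omega
  have hsq : (Real.sqrt N : ℂ) * (Real.sqrt N : ℂ) = N := by
    rw [← Complex.ofReal_mul, Real.mul_self_sqrt N.cast_nonneg, Complex.ofReal_natCast]
  have hsq0 : (Real.sqrt N : ℂ) ≠ 0 := by
    intro h
    rw [h, zero_mul] at hsq
    exact hN0 (by exact_mod_cast hsq.symm)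
  have hiso : ∀ i j, (ContinuousLinearMap.adjoint (S i)).comp (S j)
      = if i = j then ContinuousLinearMap.id ℂ (Lp ℂ 2 μC) else 0 := by
    intro i j
    refine ContinuousLinearMap.ext fun g => ext_inner_left ℂ fun f => ?_
    rw [ContinuousLinearMap.comp_apply, ContinuousLinearMap.adjoint_inner_right]
    have hL : N * inner ℂ (S i f) (S j g)
        = N * ((if i = j then 1 else 0) * inner ℂ f g) := by
      rw [L2.inner_def, L2.inner_def, ← integral_rootSum hN0 (L2.integrable_inner _ _),
        ← integral_const_mul, ← integral_const_mul]
      refine integral_congr_ae ?_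
      have hk : ∀ᵐ z ∂μC, ∀ k,
          S i f (circRoots N z k) = Real.sqrt N * m i (circRoots N z k) * f z ∧
          S j g (circRoots N z k) = Real.sqrt N * m j (circRoots N z k) * g z := by
        refine ae_all_iff.mpr fun k => ?_
        filter_upwards [(quasiMeasurePreserving_circRoots hN0 k).ae (hS i f),
          (quasiMeasurePreserving_circRoots hN0 k).ae (hS j g)] with z h1 h2
        rw [circRoots_pow hN0] at h1 h2
        exact ⟨h1, h2⟩
      filter_upwards [hk, hunitary] with z hz hU
      have hrow := sum_mul_star_of_mem_unitaryGroup hU i j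
      simp only [Matrix.of_apply] at hrow
      simp only [rootSum, RCLike.inner_apply]
      rw [← hrow, ← hsq, Finset.sum_mul, Finset.mul_sum]
      refine Finset.sum_congr rfl fun k _ => ?_
      rw [(hz k).1, (hz k).2]
      simp only [map_mul, Complex.conj_ofReal]
      ring
    rw [mul_left_cancel₀ (Nat.cast_ne_zero.mpr hN0) hL]
    split_ifs <;> simp
  refine ⟨hiso, ContinuousLinearMap.ext fun g => ?_⟩
  have hmem : ∀ i, MemLp (fun z => (Real.sqrt N : ℂ)⁻¹ *
      rootSum N (fun w => conj (m i w) * g w) z) 2 μC := fun i =>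
    (memLp_rootSum_conj_mul hN0 (hm_meas i) (hm_bdd i).choose_spec (Lp.memLp g)).const_mul _
  set F : Fin N → Lp ℂ 2 μC := fun i => (hmem i).toLp _
  have hsum : ∑ i, S i (F i) = g := by
    refine Lp.ext ?_
    have hFi : ∀ᵐ w ∂μC, ∀ i, S i (F i) w = Real.sqrt N * m i w * ((Real.sqrt N : ℂ)⁻¹ *
        ∑ k, conj (m i (circRoots N (w ^ N) k)) * g (circRoots N (w ^ N) k)) := by
      refine ae_all_iff.mpr fun i => ?_
      filter_upwards [hS i (F i),
        (quasiMeasurePreserving_pow_circle hN0).ae (hmem i).coeFn_toLp] with w h1 h2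
      rw [h1, h2, rootSum]
    filter_upwards [Lp.coeFn_finsetSum Finset.univ fun i => S i (F i), hFi,
      (quasiMeasurePreserving_pow_circle hN0).ae hunitary] with w hw hFw hU
    obtain ⟨l, hl⟩ := exists_circRoots_eq hN0 (rfl : w ^ N = w ^ N)
    have hcol : ∀ k, ∑ i, conj (m i (circRoots N (w ^ N) k)) * m i w
        = if k = l then 1 else 0 := by
      intro k
      have h := sum_star_mul_of_mem_unitaryGroup hU k l
      simp only [Matrix.of_apply] at h
      rwa [hl] at h
    rw [hw]
    simp only [Finset.sum_apply, hFw]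
    calc _ = ∑ i, ∑ k, conj (m i (circRoots N (w ^ N) k)) * m i w * g (circRoots N (w ^ N) k) := by
          refine Finset.sum_congr rfl fun i _ => ?_
          rw [mul_assoc, mul_left_comm (m i w), mul_inv_cancel_left₀ hsq0, Finset.mul_sum]
          exact Finset.sum_congr rfl fun k _ => by ring
      _ = g w := by
          rw [Finset.sum_comm]
          simp only [← Finset.sum_mul, hcol, ite_mul, one_mul, zero_mul, Finset.sum_ite_eq',
            Finset.mem_univ, if_true, hl]
  have hadj : ∀ i, ContinuousLinearMap.adjoint (S i) g = F i := by
    intro i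
    rw [← hsum, map_sum]
    have h : ∀ j, ContinuousLinearMap.adjoint (S i) (S j (F j)) = if i = j then F j else 0 := by
      intro j
      rw [← ContinuousLinearMap.comp_apply, hiso]
      split_ifs <;> simp
    simp [h]
  simp only [_root_.sum_apply, ContinuousLinearMap.comp_apply, hadj, hsum,
    ContinuousLinearMap.id_apply]
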